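/- arXiv:1902.08791 — 2 statements merged into one kernel-verified Lean document; each statement's English description precedes it below -/
import Mathlib

section
/- Let G be a finite strongly connected digraph with algebraic length 1 that is compatible with a Taylor operation t. Then G has a loop. -/
/-- There is a directed walk of length `k` from `u` to `v` in the digraph with edge relation `E`. -/
def HasWalk {A : Type*} (E : A → A → Prop) (u v : A) (k : ℕ) : Prop :=
  ∃ w : ℕ → A, w 0 = u ∧ w k = v ∧ ∀ i < k, E (w i) (w (i + 1))

/-- `t` is a Taylor operation: it is idempotent and for each coordinate `i` there is a Taylor
equation `t(z) ≈ t(z')` with entries in `{x, y}`, `zᵢ = x` and `z'ᵢ = y`, holding for all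
`x, y`. -/
def IsTaylor {A : Type*} {n : ℕ} (t : (Fin n → A) → A) : Prop :=
  (∀ a : A, t (fun _ => a) = a) ∧
  ∀ i : Fin n, ∃ z z' : Fin n → Bool, z i = true ∧ z' i = false ∧
    ∀ x y : A, t (fun j => if z j then x else y) = t (fun j => if z' j then x else y)

/-- Powers of a relation: `Pw E k x y` says there is a walk of length `k` from `x` to `y`. -/
def Pw {A : Type*} (E : A → A → Prop) : ℕ → A → A → Prop
  | 0 => fun x y => x = y
  | k + 1 => fun x z => ∃ y, E x y ∧ Pw E k y z

/-- The operation `t` is compatible with `R`. -/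
def Cmp {A I : Type*} (t : (I → A) → A) (R : A → A → Prop) : Prop :=
  ∀ u v : I → A, (∀ i, R (u i) (v i)) → R (t u) (t v)

/-- The relation `E` restricted to the set `D`. -/
def Rs {A : Type*} (E : A → A → Prop) (D : Set A) (x y : A) : Prop := x ∈ D ∧ y ∈ D ∧ E x y

/-- `x` lies on a closed walk inside `D`. -/
def Cyc {A : Type*} (E : A → A → Prop) (D : Set A) (x : A) : Prop :=
  ∃ l, 1 ≤ l ∧ Pw (Rs E D) l x x

/-- `D` is closed under `t`. -/
def Clo {A I : Type*} (t : (I → A) → A) (D : Set A) : Prop := ∀ u, (∀ i, u i ∈ D) → t u ∈ D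

/-- Proper primitive subuniverses give loops (induction hypothesis). -/
def SubLoop {A I : Type*} (t : (I → A) → A) (E : A → A → Prop) : Prop :=
  ∀ X : Set A, X ≠ Set.univ → X.Nonempty → Clo t X →
    (∃ k, 1 ≤ k ∧ ∀ x y : X, Pw (fun a b : X => E a b) k x y) → ∃ a, E a a

theorem pw_add {A : Type*} {E : A → A → Prop} (m n : ℕ) (x z : A) :
    Pw E (m + n) x z ↔ ∃ y, Pw E m x y ∧ Pw E n y z := by
  induction m generalizing x with
  | zero => simp [Pw]
  | succ m ih =>
    rw [Nat.add_right_comm]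
    simp only [Pw, ih]
    constructor
    · rintro ⟨y, h, w, h1, h2⟩; exact ⟨w, ⟨y, h, h1⟩, h2⟩
    · rintro ⟨w, ⟨y, h, h1⟩, h2⟩; exact ⟨y, h, w, h1, h2⟩

theorem pw_one {A : Type*} {E : A → A → Prop} {x y : A} (h : E x y) : Pw E 1 x y := ⟨y, h, rfl⟩

theorem pw_mul {A : Type*} {E : A → A → Prop} {l : ℕ} {x : A} (h : Pw E l x x) (m : ℕ) :
    Pw E (l * m) x x := by
  induction m with
  | zero => simp [Pw]
  | succ m ih => rw [Nat.mul_succ, pw_add]; exact ⟨x, ih, h⟩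

theorem pw_cmp {A I : Type*} {t : (I → A) → A} {E : A → A → Prop} (h : Cmp t E) (k : ℕ) :
    Cmp t (Pw E k) := by
  induction k with
  | zero => intro u v huv; exact congrArg t (funext huv)
  | succ k ih =>
    intro u v huv
    choose y hy hy' using huv
    exact ⟨t y, h _ _ hy, ih _ _ hy'⟩

theorem pw_mono {A : Type*} {E F : A → A → Prop} (h : ∀ x y, E x y → F x y) (k : ℕ) {x y : A}
    (hp : Pw E k x y) : Pw F k x y := by
  induction k generalizing x with
  | zero => exact hp
  | succ k ih => obtain ⟨z, h1, h2⟩ := hp; exact ⟨z, h _ _ h1, ih h2⟩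

theorem rs_le {A : Type*} {E : A → A → Prop} {D : Set A} (x y : A) (h : Rs E D x y) : E x y :=
  h.2.2

theorem rs_cmp {A I : Type*} {t : (I → A) → A} {E : A → A → Prop} {D : Set A} (h : Cmp t E)
    (hD : Clo t D) : Cmp t (Rs E D) := fun u v huv =>
  ⟨hD _ fun i => (huv i).1, hD _ fun i => (huv i).2.1, h _ _ fun i => (huv i).2.2⟩

theorem cyc_mem {A : Type*} {E : A → A → Prop} {D : Set A} {x : A} (h : Cyc E D x) : x ∈ D := by
  obtain ⟨l, hl, h⟩ := h
  obtain ⟨l, rfl⟩ := Nat.exists_eq_add_of_le' hl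
  obtain ⟨y, h1, _⟩ := h
  exact h1.1

/-- Total walks persist. -/
theorem pw_total {A : Type*} {E : A → A → Prop} {k : ℕ} (hk : 1 ≤ k) (h : ∀ x y, Pw E k x y)
    {m : ℕ} (hm : k ≤ m) (x y : A) : Pw E m x y := by
  induction m, hm using Nat.le_induction generalizing x with
  | base => exact h x y
  | succ m hm ih =>
    obtain ⟨k, rfl⟩ := Nat.exists_eq_add_of_le' hk
    obtain ⟨z, h1, _⟩ := h x y
    exact ⟨z, h1, ih z⟩

theorem out_nbr {A : Type*} {E : A → A → Prop} {k : ℕ} (hk : 1 ≤ k) (h : ∀ x y, Pw E k x y)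
    (x : A) : ∃ y, E x y := by
  obtain ⟨k, rfl⟩ := Nat.exists_eq_add_of_le' hk
  obtain ⟨z, h1, _⟩ := h x x
  exact ⟨z, h1⟩

/-- A nonempty finite set with out-neighbours inside has a cyclic vertex. -/
theorem exists_cyc {A : Type*} [Finite A] {E : A → A → Prop} {D : Set A} (hne : D.Nonempty)
    (h : ∀ x ∈ D, ∃ y ∈ D, E x y) : ∃ c, Cyc E D c := by
  classical
  choose! g hg hE using h
  obtain ⟨a, ha⟩ := hne
  have hmem : ∀ m, g^[m] a ∈ D := by
    intro m
    induction m with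
    | zero => exact ha
    | succ m ih => rw [Function.iterate_succ_apply']; exact hg _ ih
  have hw : ∀ m p, Pw (Rs E D) m (g^[p] a) (g^[p + m] a) := by
    intro m
    induction m with
    | zero => intro p; rfl
    | succ m ih =>
      intro p
      refine ⟨g^[p + 1] a, ⟨hmem _, hmem _, ?_⟩, ?_⟩
      · rw [Function.iterate_succ_apply']; exact hE _ (hmem _)
      · have := ih (p + 1)
        rwa [show p + 1 + m = p + (m + 1) by omega] at this
  obtain ⟨p, q, hne, he⟩ := Finite.exists_ne_map_eq_of_infinite (fun m : ℕ => g^[m] a)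
  wlog hlt : p < q generalizing p q
  · exact this q p hne.symm he.symm (by omega)
  refine ⟨g^[p] a, q - p, by omega, ?_⟩
  have := hw (q - p) p
  rw [show p + (q - p) = q by omega] at this
  have he' : g^[p] a = g^[q] a := he
  rwa [← he'] at this

/-- Common length of closed walks. -/
theorem common_len {A : Type*} [Fintype A] (E : A → A → Prop) (D : Set A) (k : ℕ) (hk : 1 ≤ k) :
    ∃ L, k ≤ L ∧ ∀ c, Cyc E D c → Pw (Rs E D) L c c := by
  classical
  have : ∀ c, ∃ l, 1 ≤ l ∧ (Cyc E D c → Pw (Rs E D) l c c) := by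
    intro c
    by_cases hc : Cyc E D c
    · obtain ⟨l, hl, h⟩ := hc; exact ⟨l, hl, fun _ => h⟩
    · exact ⟨1, le_rfl, fun h => absurd h hc⟩
  choose l hl h using this
  refine ⟨k * ∏ c, l c, ?_, ?_⟩
  · exact Nat.le_mul_of_pos_right _ (Finset.prod_pos fun c _ => hl c)
  · intro c hc
    obtain ⟨m, hm⟩ : l c ∣ k * ∏ c, l c :=
      (Finset.dvd_prod_of_mem l (Finset.mem_univ c)).mul_left k
    rw [hm]
    exact pw_mul (h c hc) m

/-- The general reduction. -/
theorem reduce {A I : Type*} {t : (I → A) → A} {E : A → A → Prop} (hE : Cmp t E)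
    (hX : SubLoop t E) {D : Set A} (hD : Clo t D) (hpr : D ≠ Set.univ) (hc : ∃ c, Cyc E D c)
    {N : ℕ} (hN : 1 ≤ N) (h : ∀ c c', Cyc E D c → Cyc E D c' → Pw (Rs E D) N c c') :
    ∃ a, E a a := by
  refine hX {x | Cyc E D x} ?_ hc ?_ ⟨N, hN, ?_⟩
  · intro he
    refine hpr (Set.eq_univ_of_forall fun x => ?_)
    have : x ∈ {x | Cyc E D x} := by rw [he]; trivial
    exact cyc_mem this
  · intro u hu
    exact ⟨N, hN, pw_cmp (rs_cmp hE hD) N u u fun i => h _ _ (hu i) (hu i)⟩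
  · have key : ∀ s (u v : {x | Cyc E D x}) m, Pw (Rs E D) s u v → Pw (Rs E D) m v u →
        Pw (fun a b : {x | Cyc E D x} => E a b) s u v := by
      intro s
      induction s with
      | zero => intro u v m h1 _; exact Subtype.ext h1
      | succ s ih =>
        rintro u v m ⟨w, h1, h2⟩ h3
        have h4 : Pw (Rs E D) (m + 1) v w := (pw_add m 1 _ _).2 ⟨u, h3, pw_one h1⟩
        have hw : Cyc E D w := ⟨s + (m + 1), by omega, (pw_add _ _ _ _).2 ⟨v, h2, h4⟩⟩
        exact ⟨⟨w, hw⟩, h1.2.2, ih ⟨w, hw⟩ v (m + 1) h2 h4⟩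
    intro x y
    exact key N x y N (h _ _ x.2 y.2) (h _ _ y.2 x.2)

/-- `D` absorbs with respect to `s` and the coordinate set `J`. -/
def AbsJ {A I : Type*} (s : (I → A) → A) (J : Set I) (D : Set A) : Prop :=
  ∀ x : I → A, (∀ j ∈ J, x j ∈ D) → s x ∈ D

theorem push {A I : Type*} {s : (I → A) → A} {E : A → A → Prop} (hE : Cmp s E) {D : Set A}
    {J : Set I} (hJ : AbsJ s J D) (L : ℕ) (x y : I → A)
    (h1 : ∀ j ∈ J, x j ∈ D ∧ Pw (Rs E D) L (x j) (y j)) (h2 : ∀ j, j ∉ J → Pw E L (x j) (y j)) :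
    Pw (Rs E D) L (s x) (s y) := by
  classical
  induction L generalizing x with
  | zero =>
    refine congrArg s (funext fun j => ?_)
    by_cases hj : j ∈ J
    · exact (h1 j hj).2
    · exact h2 j hj
  | succ L ih =>
    have : ∀ j, ∃ z, E (x j) z ∧ (j ∈ J → z ∈ D ∧ Pw (Rs E D) L z (y j)) ∧
        (j ∉ J → Pw E L z (y j)) := by
      intro j
      by_cases hj : j ∈ J
      · obtain ⟨_, z, ha, hb⟩ := h1 j hj
        exact ⟨z, ha.2.2, fun _ => ⟨ha.2.1, hb⟩, fun h => absurd hj h⟩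
      · obtain ⟨z, ha, hb⟩ := h2 j hj
        exact ⟨z, ha, fun h => absurd h hj, fun _ => hb⟩
    choose z ha hb hc using this
    exact ⟨s z, ⟨hJ _ fun j hj => (h1 j hj).1, hJ _ fun j hj => (hb j hj).1, hE _ _ ha⟩,
      ih z hb hc⟩

/-- Enlarge an absorbing set until every vertex has an out-neighbour in it. -/
theorem enlarge {A I I' : Type*} {t : (I → A) → A} {s : (I' → A) → A} {E : A → A → Prop}
    (hE : Cmp t E) (hs : Cmp s E) (hout : ∀ x, ∃ y, E x y) (W : Set (Set I')) (k : ℕ) (C : Set A)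
    (hne : C.Nonempty) (hpr : C ≠ Set.univ) (hC : Clo t C) (hW : ∀ J ∈ W, AbsJ s J C)
    (hk : ∀ x, ∃ y ∈ C, Pw E k x y) :
    ∃ D : Set A, D.Nonempty ∧ D ≠ Set.univ ∧ Clo t D ∧ (∀ J ∈ W, AbsJ s J D) ∧
      ∀ x, ∃ y ∈ D, E x y := by
  classical
  induction k generalizing C with
  | zero =>
    refine absurd (Set.eq_univ_of_forall fun x => ?_) hpr
    obtain ⟨y, hy, rfl⟩ := hk x
    exact hy
  | succ k ih =>
    by_cases hall : ∀ x, ∃ y ∈ C, E x y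
    · exact ⟨C, hne, hpr, hC, hW, hall⟩
    · refine ih {x | ∃ y ∈ C, E x y} ?_ ?_ ?_ ?_ ?_
      · obtain ⟨c, hc⟩ := hne
        obtain ⟨y, hy, hp⟩ := hk c
        rw [pw_add] at hp
        obtain ⟨z, _, w, h1, h2⟩ := hp
        obtain rfl : w = y := h2
        exact ⟨z, w, hy, h1⟩
      · intro he
        exact hall fun x => by
          have : x ∈ {x | ∃ y ∈ C, E x y} := by rw [he]; trivial
          exact this
      · intro u hu
        choose y hy hy' using hu
        exact ⟨t y, hC _ hy, hE _ _ hy'⟩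
      · intro J hJ u hu
        have : ∀ j, ∃ z, E (u j) z ∧ (j ∈ J → z ∈ C) := by
          intro j
          by_cases hj : j ∈ J
          · obtain ⟨z, h1, h2⟩ := hu j hj; exact ⟨z, h2, fun _ => h1⟩
          · obtain ⟨z, h1⟩ := hout (u j); exact ⟨z, h1, fun h => absurd h hj⟩
        choose z h1 h2 using this
        exact ⟨s z, hW J hJ z h2, hs _ _ h1⟩
      · intro x
        obtain ⟨y, hy, hp⟩ := hk x
        rw [pw_add] at hp
        obtain ⟨z, h0, w, h1, h2⟩ := hp
        obtain rfl : w = y := h2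
        exact ⟨z, ⟨w, hy, h1⟩, h0⟩

/-- Step 1: projective-type absorption at one coordinate. -/
theorem step_one {A : Type*} [Fintype A] {n : ℕ} {t : (Fin n → A) → A} {E : A → A → Prop}
    (ht : IsTaylor t) (hE : Cmp t E) (hX : SubLoop t E) {k : ℕ} (hk : 1 ≤ k)
    (hp : ∀ x y, Pw E k x y) (i : Fin n) (C : Set A) (hne : C.Nonempty) (hpr : C ≠ Set.univ)
    (hC : AbsJ t {i} C) : ∃ a, E a a := by
  obtain ⟨D, hDne, hDpr, hDc, hDW, hDo⟩ := enlarge hE hE (out_nbr hk hp) {{i}} k C hne hpr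
    (fun u hu => hC u fun j _ => hu j) (fun J hJ => by rw [Set.mem_singleton_iff.1 hJ]; exact hC)
    (fun x => by obtain ⟨c, hc⟩ := hne; exact ⟨c, hc, hp x c⟩)
  have hD := hDW {i} rfl
  obtain ⟨L, hL, hLc⟩ := common_len E D k hk
  refine reduce hE hX hDc hDpr (exists_cyc hDne fun x _ => hDo x) (N := L + L) (by omega) ?_
  intro c c' hc hc'
  obtain ⟨z, z', hz, hz', he⟩ := ht.2 i
  have up : ∀ c, Cyc E D c → ∀ x : Fin n → A, x i = c →
      Pw (Rs E D) L c (t x) ∧ Pw (Rs E D) L (t x) c := by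
    intro c hc x hx
    have h1 := push hE hD L (fun _ => c) x
      (by rintro j rfl; exact ⟨cyc_mem hc, by rw [hx]; exact hLc c hc⟩)
      (fun j _ => pw_total hk hp hL _ _)
    have h2 := push hE hD L x (fun _ => c)
      (by rintro j rfl; rw [hx]; exact ⟨cyc_mem hc, hLc c hc⟩)
      (fun j _ => pw_total hk hp hL _ _)
    rw [ht.1] at h1 h2
    exact ⟨h1, h2⟩
  rw [pw_add]
  refine ⟨_, (up c hc (fun j => if z j then c else c') (by simp [hz])).1, ?_⟩
  rw [he]
  exact (up c' hc' _ (by simp [hz'])).2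

/-- Step 4: absorption in all coordinates but one. -/
theorem step_abs {A I J : Type*} [Fintype A] [Fintype J] {t : (I → A) → A} {s : (J → A) → A}
    {E : A → A → Prop} (hs1 : ∀ a, s (fun _ => a) = a)
    (hE : Cmp t E) (hsE : Cmp s E) (hX : SubLoop t E) {k : ℕ} (hk : 1 ≤ k)
    (hp : ∀ x y, Pw E k x y) (C : Set A) (hne : C.Nonempty) (hpr : C ≠ Set.univ)
    (hCt : Clo t C) (hC : ∀ w, AbsJ s {w}ᶜ C) : ∃ a, E a a := by
  classical
  obtain ⟨D, hDne, hDpr, hDc, hDW, hDo⟩ := enlarge hE hsE (out_nbr hk hp)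
    (Set.range fun w : J => ({w}ᶜ : Set J)) k C hne hpr hCt
    (by rintro _ ⟨w, rfl⟩; exact hC w)
    (fun x => by obtain ⟨c, hc⟩ := hne; exact ⟨c, hc, hp x c⟩)
  have hD : ∀ w, AbsJ s {w}ᶜ D := fun w => hDW _ ⟨w, rfl⟩
  obtain ⟨L, hL, hLc⟩ := common_len E D k hk
  refine reduce hE hX hDc hDpr (exists_cyc hDne fun x _ => hDo x)
    (N := L + L * Fintype.card J) (by omega) ?_
  intro c c' hc hc'
  rw [pw_add]
  refine ⟨c, hLc c hc, ?_⟩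
  have key : ∀ F : Finset J,
      Pw (Rs E D) (L * F.card) c (s fun j => if j ∈ F then c' else c) := by
    intro F
    induction F using Finset.induction_on with
    | empty => simp [Pw, hs1]
    | insert w F hw ih =>
      rw [Finset.card_insert_of_notMem hw, Nat.mul_succ, pw_add]
      refine ⟨_, ih, push hsE (hD w) L _ _ ?_ ?_⟩
      · intro j hj
        have hj' : j ≠ w := hj
        by_cases hF : j ∈ F
        · simpa [hF, hj'] using ⟨cyc_mem hc', hLc c' hc'⟩
        · simpa [hF, hj'] using ⟨cyc_mem hc, hLc c hc⟩
      · intro j _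
        exact pw_total hk hp hL _ _
  simpa [hs1, Finset.card_univ] using key Finset.univ

/-- Step K: a proper congruence containing the linkedness of `E^k`. -/
theorem step_cong {A I : Type*} [Finite A] {t : (I → A) → A} {E : A → A → Prop}
    (hid : ∀ a, t (fun _ => a) = a) (hE : Cmp t E) (hX : SubLoop t E) {k : ℕ}
    (hp : ∀ x y, Pw E (k + 1) x y) (θ : A → A → Prop) (hθ : Cmp t θ)
    (hr : ∀ x, θ x x) (hsy : ∀ x y, θ x y → θ y x) (htr : ∀ x y z, θ x y → θ y z → θ x z)
    (hpr : ∃ x y, ¬ θ x y) (hl : ∀ x x' y, Pw E k x y → Pw E k x' y → θ x x') :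
    ∃ a, E a a := by
  obtain ⟨a, b, hab⟩ := hpr
  have hout : ∀ m x, ∃ y, Pw E m x y := by
    intro m
    induction m with
    | zero => intro x; exact ⟨x, rfl⟩
    | succ m ih =>
      intro x
      obtain ⟨z, hz⟩ := out_nbr (by omega) hp x
      obtain ⟨y, hy⟩ := ih z
      exact ⟨y, z, hz, hy⟩
  refine reduce (D := {x | θ a x}) hE hX ?_ ?_ (exists_cyc ⟨a, hr a⟩ ?_) (N := k + 1) (by omega) ?_
  · intro u hu
    have := hθ (fun _ => a) u hu
    rwa [hid] at this
  · intro he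
    have : b ∈ {x | θ a x} := by rw [he]; trivial
    exact hab this
  · intro x hx
    obtain ⟨y, hy⟩ := hout k x
    obtain ⟨z, h1, h2⟩ := hp x y
    exact ⟨z, htr _ _ _ hx (hl _ _ _ hy h2), h1⟩
  · intro c c' hc hc'
    have hback : ∀ s, ∃ v, θ a v ∧ Pw E s v c' := by
      intro s
      obtain ⟨l, hl1, hl2⟩ := hc'
      have h := pw_mul hl2 (s + 1)
      have hge : s + 1 ≤ l * (s + 1) := Nat.le_mul_of_pos_left _ hl1
      rw [show l * (s + 1) = (l * (s + 1) - (s + 1)) + (s + 1) by omega, pw_add] at h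
      obtain ⟨v, _, w, h1, h2⟩ := h
      exact ⟨w, h1.2.1, pw_mono rs_le s h2⟩
    have hin : ∀ s, s ≤ k → ∀ u, Pw E s u c' → θ a u := by
      intro s hs u hu
      obtain ⟨v, hv, hv'⟩ := hback s
      obtain ⟨y, hy⟩ := hout (k - s) c'
      refine htr _ _ _ hv (hl v u y ?_ ?_)
      · rw [show k = s + (k - s) by omega, pw_add]; exact ⟨c', hv', hy⟩
      · rw [show k = s + (k - s) by omega, pw_add]; exact ⟨c', hu, hy⟩
    have hw : ∀ s, s ≤ k → ∀ u, Pw E s u c' → Pw (Rs E {x | θ a x}) s u c' := by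
      intro s
      induction s with
      | zero => intro _ u hu; exact hu
      | succ s ih =>
        rintro hs u ⟨v, h1, h2⟩
        exact ⟨v, ⟨hin (s + 1) hs u ⟨v, h1, h2⟩, hin s (by omega) v h2, h1⟩, ih (by omega) v h2⟩
    obtain ⟨u, h1, h2⟩ := hp c c'
    exact ⟨u, ⟨cyc_mem hc, hin k le_rfl u h2, h1⟩, hw k le_rfl u h2⟩

/-- A proper relation in which every pair has a common out-neighbour yields a proper relation
with a nonempty center. -/
theorem exists_center {A I : Type*} [Fintype A] {t : (I → A) → A}
    (hid : ∀ a, t (fun _ => a) = a) (S : A → A → Prop) (hS : Cmp t S)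
    (hpr : ∃ x y, ¬ S x y) (hsur : ∀ y, ∃ x, S x y) (hpair : ∀ x x', ∃ y, S x y ∧ S x' y) :
    ∃ Q : A → A → Prop, Cmp t Q ∧ (∃ x y, ¬ Q x y) ∧ (∀ y, ∃ x, Q x y) ∧ ∃ c, ∀ x, Q x c := by
  classical
  by_cases hF : ∃ F : Finset A, ∃ f, (∀ u v, ∃ y, S u y ∧ S v y ∧ ∀ a ∈ F, S a y) ∧
      ¬ (∀ u v, ∃ y, S u y ∧ S v y ∧ ∀ a ∈ insert f F, S a y)
  · obtain ⟨F, f, h1, h2⟩ := hF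
    push Not at h2
    obtain ⟨x, x', h2⟩ := h2
    refine ⟨fun u v => ∃ y, S u y ∧ S v y ∧ S x' y ∧ ∀ a ∈ F, S a y, ?_, ⟨f, x, ?_⟩, ?_, x', ?_⟩
    · intro u v huv
      choose y ha hb hc hd using huv
      refine ⟨t y, hS _ _ ha, hS _ _ hb, ?_, ?_⟩
      · have := hS (fun _ => x') y hc
        rwa [hid] at this
      · intro a haF
        have := hS (fun _ => a) y fun i => hd i a haF
        rwa [hid] at this
    · rintro ⟨y, ha, hb, hc, hd⟩
      obtain ⟨a, haF, hay⟩ := h2 y hb hc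
      rcases Finset.mem_insert.1 haF with rfl | h
      · exact hay ha
      · exact hay (hd a h)
    · intro v
      obtain ⟨y, ha, hb, hc⟩ := h1 x' v
      exact ⟨x', y, ha, hb, ha, hc⟩
    · intro u
      obtain ⟨y, ha, hb, hc⟩ := h1 u x'
      exact ⟨y, ha, hb, hb, hc⟩
  · push Not at hF
    have all : ∀ F : Finset A, ∀ u v, ∃ y, S u y ∧ S v y ∧ ∀ a ∈ F, S a y := by
      intro F
      induction F using Finset.induction_on with
      | empty => intro u v; obtain ⟨y, h⟩ := hpair u v; exact ⟨y, h.1, h.2, by simp⟩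
      | insert f F _ ih => exact hF F f ih
    obtain ⟨x, y, hxy⟩ := id hpr
    obtain ⟨c, _, _, hc⟩ := all Finset.univ x x
    exact ⟨S, hS, hpr, hsur, c, fun a => hc a (Finset.mem_univ a)⟩

/-- A composite operation transitive in every coordinate. -/
theorem exists_transitive {A : Type*} [Fintype A] {n : ℕ} {t : (Fin n → A) → A}
    (hid : ∀ a, t (fun _ => a) = a)
    (htot : ∀ (i : Fin n) (C : Set A), C.Nonempty → AbsJ t {i} C → C = Set.univ) (N : ℕ) :
    ∃ (J : Type) (_ : Fintype J) (s : (J → A) → A), (∀ a, s (fun _ => a) = a) ∧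
      (∀ R, Cmp t R → Cmp s R) ∧
      ∀ w a, {b | ∃ x : J → A, x w = a ∧ s x = b} = Set.univ ∨
        N ≤ {b | ∃ x : J → A, x w = a ∧ s x = b}.ncard := by
  classical
  induction N with
  | zero =>
    exact ⟨Unit, inferInstance, fun x => x (), fun a => rfl, fun R hR u v h => h (),
      fun w a => Or.inr (Nat.zero_le _)⟩
  | succ N ih =>
    obtain ⟨J, _, s, h1, h2, h3⟩ := ih
    refine ⟨Fin n × J, inferInstance, fun x => t fun i => s fun w => x (i, w), ?_, ?_, ?_⟩
    · intro a; simp only [h1, hid]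
    · intro R hR u v h
      exact hR _ _ fun i => h2 R hR _ _ fun w => h (i, w)
    · rintro ⟨i, w⟩ a
      set B := {b | ∃ x : J → A, x w = a ∧ s x = b} with hB
      set B' := {b | ∃ x : Fin n × J → A, x (i, w) = a ∧ (t fun i => s fun w => x (i, w)) = b}
        with hB'
      have hstep : ∀ y : Fin n → A, y i ∈ B → t y ∈ B' := by
        rintro y ⟨x, hx, hxy⟩
        refine ⟨fun p => if p.1 = i then x p.2 else y p.1, by simp [hx], ?_⟩
        congr 1
        funext j
        by_cases hj : j = i
        · subst hj; simpa using hxy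
        · simp [hj, h1]
      have hsub : B ⊆ B' := by
        intro b hb
        have := hstep (fun _ => b) hb
        rwa [hid] at this
      rcases h3 w a with h | h
      · left
        rw [← hB] at h
        exact Set.eq_univ_of_univ_subset (h ▸ hsub)
      · by_cases hu : B = Set.univ
        · left; exact Set.eq_univ_of_univ_subset (hu ▸ hsub)
        · right
          have hss : B ⊂ B' := by
            refine lt_of_le_of_ne hsub fun he => hu (htot i B ⟨a, fun _ => a, rfl, h1 a⟩ ?_)
            intro y hy
            have := hstep y (hy i rfl)
            rwa [← he] at this
          have := Set.ncard_lt_ncard hss (Set.toFinite _)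
          rw [← hB] at h
          omega

/-- The main inductive step. -/
theorem main_step {A : Type*} [Fintype A] {n : ℕ} {t : (Fin n → A) → A} {E : A → A → Prop}
    [Nonempty A] (ht : IsTaylor t) (hE : Cmp t E) (hX : SubLoop t E)
    (hp : ∃ k, 1 ≤ k ∧ ∀ x y, Pw E k x y) : ∃ a, E a a := by
  classical
  by_contra hno
  have htot : ∀ (i : Fin n) (C : Set A), C.Nonempty → AbsJ t {i} C → C = Set.univ := by
    intro i C hne hC
    by_contra hpr
    obtain ⟨k, hk, hp⟩ := hp
    exact hno (step_one ht hE hX hk hp i C hne hpr hC)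
  obtain ⟨J, _, s, hs1, hs2, hs3⟩ := exists_transitive ht.1 htot (Fintype.card A)
  have htrans : ∀ w a b, ∃ x : J → A, x w = a ∧ s x = b := by
    intro w a b
    have : {b | ∃ x : J → A, x w = a ∧ s x = b} = Set.univ := by
      rcases hs3 w a with h | h
      · exact h
      · refine Set.eq_of_subset_of_ncard_le (Set.subset_univ _) ?_ (Set.toFinite _)
        rwa [Set.ncard_univ, Nat.card_eq_fintype_card]
    have hb : b ∈ {b | ∃ x : J → A, x w = a ∧ s x = b} := by rw [this]; trivial
    exact hb
  -- no proper relation has a center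
  have hcen : ∀ S : A → A → Prop, Cmp t S → (∃ x y, ¬ S x y) → (∀ y, ∃ x, S x y) →
      ¬ ∀ x x', ∃ y, S x y ∧ S x' y := by
    intro S hS hpr hsur hpair
    obtain ⟨Q, hQ, ⟨x, y, hxy⟩, hQs, c, hc⟩ := exists_center ht.1 S hS hpr hsur hpair
    obtain ⟨k, hk, hp⟩ := hp
    refine hno (step_abs hs1 hE (hs2 E hE) hX hk hp {b | ∀ a, Q a b} ⟨c, hc⟩ ?_ ?_ ?_)
    · intro he
      have : y ∈ {b | ∀ a, Q a b} := by rw [he]; trivial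
      exact hxy (this x)
    · intro u hu a
      have := hQ (fun _ => a) u fun i => hu i a
      rwa [ht.1] at this
    · intro w b hb a
      obtain ⟨a', ha'⟩ := hQs (b w)
      obtain ⟨x, hx, rfl⟩ := htrans w a' a
      refine hs2 Q hQ _ _ fun j => ?_
      by_cases hj : j = w
      · subst hj; rwa [hx]
      · exact hb j hj (x j)
  -- the least total power
  have hex : ∃ k, (∀ x y, Pw E (k + 1) x y) ∧ ∃ x y, ¬ Pw E k x y := by
    by_contra hcon
    push Not at hcon
    obtain ⟨k, hk, hp⟩ := hp
    have h0 : ∀ m, (∀ x y, Pw E (m + 1) x y) → ∀ x y, Pw E 1 x y := by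
      intro m
      induction m with
      | zero => exact id
      | succ m ih => intro h; exact ih (hcon _ h)
    obtain ⟨k, rfl⟩ := Nat.exists_eq_add_of_le' hk
    obtain ⟨a⟩ := ‹Nonempty A›
    obtain ⟨b, h1, h2⟩ := h0 k hp a a
    obtain rfl : b = a := h2
    exact hno ⟨b, h1⟩
  obtain ⟨k, hk1, hk2⟩ := hex
  have hkc := pw_cmp hE k
  have hsur : ∀ y, ∃ x, Pw E k x y := by
    intro y
    obtain ⟨x, _, h⟩ := hk1 y y
    exact ⟨x, h⟩
  have hout : ∀ x, ∃ y, Pw E k x y := by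
    intro x
    have := hk1 x x
    rw [pw_add] at this
    obtain ⟨y, h, _⟩ := this
    exact ⟨y, h⟩
  have hlink := hcen _ hkc hk2 hsur
  -- maximal proper tolerance
  let P : Set (A → A → Prop) := {T | Cmp t T ∧ (∀ x, T x x) ∧ (∀ x y, T x y → T y x) ∧
    (∃ x y, ¬ T x y) ∧ ∀ x x' y, Pw E k x y → Pw E k x' y → T x x'}
  have hPne : (fun x x' => ∃ y, Pw E k x y ∧ Pw E k x' y) ∈ P := by
    refine ⟨?_, ?_, ?_, ?_, ?_⟩
    · intro u v huv
      choose y h1 h2 using huv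
      exact ⟨t y, hkc _ _ h1, hkc _ _ h2⟩
    · intro x; obtain ⟨y, h⟩ := hout x; exact ⟨y, h, h⟩
    · rintro x y ⟨z, h1, h2⟩; exact ⟨z, h2, h1⟩
    · push Not at hlink ⊢; exact hlink
    · intro x x' y h1 h2; exact ⟨y, h1, h2⟩
  obtain ⟨T, hT⟩ := (Set.toFinite P).exists_maximal ⟨_, hPne⟩
  obtain ⟨hTc, hTr, hTs, hTp, hTl⟩ := hT.prop
  have hTT : ¬ ∀ x x', ∃ y, T x y ∧ T x' y := hcen T hTc hTp fun y => ⟨y, hTr y⟩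
  have hmem : (fun x x' => ∃ y, T x y ∧ T x' y) ∈ P := by
    refine ⟨?_, ?_, ?_, ?_, ?_⟩
    · intro u v huv
      choose y h1 h2 using huv
      exact ⟨t y, hTc _ _ h1, hTc _ _ h2⟩
    · intro x; exact ⟨x, hTr x, hTr x⟩
    · rintro x y ⟨z, h1, h2⟩; exact ⟨z, h2, h1⟩
    · push Not at hTT ⊢; exact hTT
    · intro x x' y h1 h2; exact ⟨x', hTl _ _ _ h1 h2, hTr x'⟩
  have hle : (fun x x' => ∃ y, T x y ∧ T x' y) ≤ T :=
    hT.le_of_ge hmem fun x x' h => ⟨x', h, hTr x'⟩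
  exact hno (step_cong ht.1 hE hX hk1 T hTc hTr hTs
    (fun x y z h1 h2 => hle x z ⟨y, h1, hTs _ _ h2⟩) hTp hTl)

theorem main_ind (m : ℕ) : ∀ {A : Type*} [Fintype A] [Nonempty A] {n : ℕ} {t : (Fin n → A) → A}
    {E : A → A → Prop}, Fintype.card A = m → IsTaylor t → Cmp t E →
    (∃ k, 1 ≤ k ∧ ∀ x y, Pw E k x y) → ∃ a, E a a := by
  classical
  induction m using Nat.strong_induction_on with
  | _ m ih =>
    intro A _ _ n t E hm ht hE hp
    refine main_step ht hE ?_ hp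
    intro X hXp hXn hXc hXk
    have : Nonempty X := hXn.to_subtype
    have hlt : Fintype.card X < m := by
      rw [← hm]
      obtain ⟨x, hx⟩ := (Set.ne_univ_iff_exists_notMem X).1 hXp
      exact Fintype.card_subtype_lt hx
    obtain ⟨a, ha⟩ := ih _ hlt (A := X) (n := n)
      (t := fun u => ⟨t fun i => u i, hXc _ fun i => (u i).2⟩) (E := fun a b => E a b) rfl
      ⟨fun a => Subtype.ext (ht.1 a), fun i => by
        obtain ⟨z, z', h1, h2, h3⟩ := ht.2 i
        refine ⟨z, z', h1, h2, fun x y => Subtype.ext ?_⟩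
        have := h3 x y
        simpa only [apply_ite] using this⟩
      (fun u v h => hE _ _ h) hXk
    exact ⟨a, ha⟩

theorem hasWalk_pw {A : Type*} {E : A → A → Prop} (k : ℕ) {u v : A} (h : HasWalk E u v k) :
    Pw E k u v := by
  induction k generalizing u with
  | zero => obtain ⟨w, rfl, rfl, _⟩ := h; rfl
  | succ k ih =>
    obtain ⟨w, rfl, rfl, h⟩ := h
    exact ⟨w 1, h 0 (by omega), ih ⟨fun i => w (i + 1), rfl, rfl, fun i hi => h (i + 1) (by omega)⟩⟩

theorem primitive {A : Type*} [Fintype A] (a : A) (E : A → A → Prop)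
    (hsc : ∀ u v : A, ∃ k, Pw E k u v)
    (hal : ∀ m : ℕ, 2 ≤ m → ¬ ∃ f : A → ZMod m, ∀ u v, E u v → f v = f u + 1) :
    ∃ k, 1 ≤ k ∧ ∀ x y, Pw E k x y := by
  classical
  choose len hlen using hsc
  let S : AddSubmonoid ℕ :=
    { carrier := {l | Pw E l a a}
      zero_mem' := rfl
      add_mem' := fun {x y} h1 h2 => (pw_add x y a a).2 ⟨a, h1, h2⟩ }
  have hdiv : ∀ m, 2 ≤ m → ¬ ∀ l, Pw E l a a → m ∣ l := by
    intro m hm hd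
    refine hal m hm ⟨fun v => (len a v : ZMod m), fun u v huv => ?_⟩
    have h1 := hd (len a u + (1 + len v a))
      ((pw_add _ _ _ _).2 ⟨u, hlen a u, (pw_add _ _ _ _).2 ⟨v, pw_one huv, hlen v a⟩⟩)
    have h2 := hd (len a v + len v a) ((pw_add _ _ _ _).2 ⟨v, hlen a v, hlen v a⟩)
    rw [← ZMod.natCast_eq_zero_iff] at h1 h2
    push_cast at h1 h2
    linear_combination h2 - h1
  have hg : Nat.setGcd (S : Set ℕ) = 1 := by
    by_contra hne
    by_cases h0 : Nat.setGcd (S : Set ℕ) = 0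
    · refine hdiv 2 le_rfl fun l hl => ?_
      have : Nat.setGcd (S : Set ℕ) ∣ l := Nat.setGcd_dvd_of_mem hl
      rw [h0, zero_dvd_iff] at this
      simp [this]
    · refine hdiv (Nat.setGcd (S : Set ℕ)) (by omega) fun l hl => ?_
      exact Nat.setGcd_dvd_of_mem (s := (S : Set ℕ)) hl
  obtain ⟨N, hN⟩ := Nat.exists_mem_closure_of_ge (S : Set ℕ)
  rw [hg, AddSubmonoid.closure_eq] at hN
  refine ⟨N + 1 + ∑ x, len x a + ∑ y, len a y, by omega, fun x y => ?_⟩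
  have hx : len x a ≤ ∑ x, len x a :=
    Finset.single_le_sum (f := fun x => len x a) (fun _ _ => Nat.zero_le _) (Finset.mem_univ x)
  have hy : len a y ≤ ∑ y, len a y :=
    Finset.single_le_sum (f := fun y => len a y) (fun _ _ => Nat.zero_le _) (Finset.mem_univ y)
  obtain ⟨r, hr⟩ : ∃ r, N + 1 + ∑ x, len x a + ∑ y, len a y = len x a + (r + len a y) ∧ N ≤ r :=
    ⟨N + 1 + ∑ x, len x a + ∑ y, len a y - len x a - len a y, by omega, by omega⟩
  rw [hr.1, pw_add]
  refine ⟨a, hlen x a, (pw_add _ _ _ _).2 ⟨a, ?_, hlen a y⟩⟩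
  exact hN r hr.2 (one_dvd _)

/-- Loop lemma for strongly connected digraphs: a finite strongly connected digraph with
algebraic length 1 compatible with a Taylor operation has a loop. -/
theorem loop_lemma_strongly_connected {A : Type*} [Fintype A] {n : ℕ}
    (E : A → A → Prop) (t : (Fin n → A) → A)
    (ht : IsTaylor t)
    (hcomp : ∀ u v : Fin n → A, (∀ i, E (u i) (v i)) → E (t u) (t v))
    (hsc : ∀ u v : A, ∃ k, HasWalk E u v k)
    (hal : ∀ m : ℕ, 2 ≤ m → ¬ ∃ f : A → ZMod m, ∀ u v, E u v → f v = f u + 1) :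
    ∃ a : A, E a a := by
  have hne : Nonempty A := by
    by_contra h
    rw [not_nonempty_iff] at h
    exact hal 2 le_rfl ⟨fun a => isEmptyElim a, fun u => isEmptyElim u⟩
  obtain ⟨a⟩ := id hne
  refine main_ind _ rfl ht hcomp (primitive a E (fun u v => ?_) hal)
  obtain ⟨k, hk⟩ := hsc u v
  exact ⟨k, hasWalk_pw k hk⟩
end

section
/- Let 𝔸 be an idempotent algebra that satisfies a Taylor equational condition locally on a subset X. Then 𝔸 has a term operation d of arity 12 satisfying the double loop equations d(x,x,x,x,x,x,y,y,y,y,y,y) = d(x,x,y,y,y,y,x,x,x,x,y,y) and d(x,y,x,x,y,y,x,x,y,y,x,y) = d(y,x,x,y,x,y,x,y,x,y,y,x) for all x, y ∈ X. -/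
/-- Term operations of an algebra with basic operations `op i : A^(ar i) → A`: the clone
generated by the basic operations, i.e. the smallest collection of finitary operations
containing all projections and closed under composition with basic operations. -/
inductive IsTermOp {A : Type*} {I : Type*} {ar : I → ℕ}
    (op : ∀ i : I, (Fin (ar i) → A) → A) : ∀ {k : ℕ}, ((Fin k → A) → A) → Prop
  | proj {k : ℕ} (j : Fin k) : IsTermOp op (fun x => x j)
  | comp {k : ℕ} (i : I) (g : Fin (ar i) → (Fin k → A) → A)
      (hg : ∀ j, IsTermOp op (g j)) :
      IsTermOp op (fun x => op i (fun j => g j x))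

namespace DLoop

/-- infinite words over `Fin n` -/
def tl {n : ℕ} (s : ℕ → Fin n) : ℕ → Fin n := fun i => s (i + 1)

def cons {n : ℕ} (j : Fin n) (s : ℕ → Fin n) : ℕ → Fin n
  | 0 => j
  | i + 1 => s i

/-- iterated application of `t` to a function of infinite words, cut at depth `N` -/
def E {n : ℕ} {B : Type*} (t : (Fin n → B) → B) (s0 : ℕ → Fin n) :
    ℕ → ((ℕ → Fin n) → B) → B
  | 0, f => f s0
  | N + 1, f => t (fun j => E t s0 N (fun s => f (cons j s)))

section
variable {n : ℕ} {B : Type*} (t : (Fin n → B) → B) (s0 : ℕ → Fin n)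

theorem E_mono (G : B → B → Prop)
    (hG : ∀ p q : Fin n → B, (∀ j, G (p j) (q j)) → G (t p) (t q)) (N : ℕ) :
    ∀ f g : (ℕ → Fin n) → B, (∀ s, G (f s) (g s)) → G (E t s0 N f) (E t s0 N g) := by
  induction N with
  | zero => intro f g h; exact h _
  | succ N ih => intro f g h; exact hG _ _ (fun j => ih _ _ (fun s => h _))

theorem E_const (hid : ∀ b, t (fun _ => b) = b) (N : ℕ) (b : B) :
    E t s0 N (fun _ => b) = b := by
  induction N with
  | zero => rfl
  | succ N ih => simp only [E, ih, hid]

theorem E_succ (hid : ∀ b, t (fun _ => b) = b) (N : ℕ) :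
    ∀ f : (ℕ → Fin n) → B, (∀ s s', (∀ i < N, s i = s' i) → f s = f s') →
      E t s0 (N + 1) f = E t s0 N f := by
  induction N with
  | zero =>
    intro f h
    have : ∀ s, f s = f s0 := fun s => h s s0 (by simp)
    simp only [E, this, hid]
  | succ N ih =>
    intro f h
    show t _ = t _
    congr 1
    funext j
    apply ih
    intro s s' hs
    apply h
    intro i hi
    cases i with
    | zero => rfl
    | succ i => exact hs i (by omega)

theorem E_tl (hid : ∀ b, t (fun _ => b) = b) (N : ℕ) (f : (ℕ → Fin n) → B) :
    E t s0 (N + 1) (fun s => f (tl s)) = E t s0 N f := by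
  show t (fun j => E t s0 N f) = _
  exact hid _

end

def mk {n : ℕ} (s : ℕ → Fin n) : Prop :=
  (s 0 ≠ s 1 ∧ s 1 = s 2) ∨ (s 0 < s 1 ∧ s 2 < s 1 ∧ s 2 ≠ s 3)

instance {n : ℕ} (s : ℕ → Fin n) : Decidable (mk s) := by unfold mk; infer_instance

theorem mk_tl {n : ℕ} (s : ℕ → Fin n) (h : mk s) : ¬ mk (tl s) := by
  unfold mk tl at *
  simp only [Nat.zero_add, Nat.reduceAdd] at *
  grind

def D {n : ℕ} : ℕ → (ℕ → Fin n) → ℕ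
  | 0, _ => 0
  | k + 1, s => if mk s then 0 else D k (tl s) + 1

theorem D_dep {n : ℕ} (k : ℕ) : ∀ s s' : ℕ → Fin n, (∀ i < k + 4, s i = s' i) →
    D k s = D k s' := by
  induction k with
  | zero => intros; rfl
  | succ k ih =>
    intro s s' h
    have h1 : mk s ↔ mk s' := by
      unfold mk
      rw [h 0 (by omega), h 1 (by omega), h 2 (by omega), h 3 (by omega)]
    have h2 : D k (tl s) = D k (tl s') := ih _ _ (fun i hi => h (i + 1) (by omega))
    simp only [D, h1, h2]

theorem D_fuel {n : ℕ} (k : ℕ) : ∀ s : ℕ → Fin n,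
    (∃ i < k, mk (fun m => s (m + i))) → D (k + 1) s = D k s := by
  induction k with
  | zero => rintro s ⟨i, hi, _⟩; omega
  | succ k ih =>
    rintro s ⟨i, hi, h⟩
    by_cases hm : mk s
    · simp [D, hm]
    · have : D (k + 1) (tl s) = D k (tl s) := by
        apply ih
        cases i with
        | zero => exact absurd h hm
        | succ i =>
          refine ⟨i, by omega, ?_⟩
          have e : (fun m => tl s (m + i)) = (fun m => s (m + (i + 1))) := by
            funext m; simp [tl, Nat.add_assoc]
          rw [e]; exact h
      rw [D, if_neg hm, this]
      conv_rhs => rw [D, if_neg hm]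

theorem exists_mk {n : ℕ} (s : ℕ → Fin n) (h01 : s 0 ≠ s 1) :
    ∃ i < 2 * n + 3, mk (fun m => s (m + i)) := by
  by_contra hcon
  push Not at hcon
  have hm : ∀ i < 2 * n + 3, ¬ ((s i ≠ s (i + 1) ∧ s (i + 1) = s (i + 2)) ∨
      (s i < s (i + 1) ∧ s (i + 2) < s (i + 1) ∧ s (i + 2) ≠ s (i + 3))) := by
    intro i hi
    have := hcon i hi
    unfold mk at this
    simpa only [Nat.zero_add, Nat.add_comm, Nat.add_zero] using this
  have hne : ∀ i < 2 * n + 4, s i ≠ s (i + 1) := by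
    intro i
    induction i with
    | zero => intro _; exact h01
    | succ i ih =>
      intro hi
      have h1 := ih (by omega)
      have h2 := hm i (by omega)
      intro h3
      exact h2 (Or.inl ⟨h1, h3⟩)
  have hasc : ∀ i < 2 * n + 2, s i < s (i + 1) → s (i + 1) < s (i + 2) := by
    intro i hi h
    have h2 := hm i (by omega)
    have h3 := hne (i + 1) (by omega)
    have h4 := hne (i + 2) (by omega)
    by_contra h5
    exact h2 (Or.inr ⟨h, lt_of_le_of_ne (not_lt.mp h5) (Ne.symm h3), h4⟩)
  have hno : ∀ i < n + 1, ¬ s i < s (i + 1) := by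
    intro i hi h
    have key : ∀ k ≤ n, k ≤ (s (i + k)).val ∧ s (i + k) < s (i + k + 1) := by
      intro k
      induction k with
      | zero => intro _; exact ⟨Nat.zero_le _, h⟩
      | succ k ih =>
        intro hk
        obtain ⟨h1, h2⟩ := ih (by omega)
        refine ⟨?_, hasc (i + k) (by omega) h2⟩
        have : (s (i + k)).val < (s (i + (k + 1))).val := h2
        omega
    have := (key n le_rfl).1
    have := (s (i + n)).isLt
    omega
  have hdesc : ∀ k ≤ n, (s k).val + k ≤ (s 0).val := by
    intro k
    induction k with
    | zero => intro _; simp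
    | succ k ih =>
      intro hk
      have h1 := ih (by omega)
      have h2 := hno k (by omega)
      have h3 := hne k (by omega)
      have : (s (k + 1)).val < (s k).val := 
        (lt_of_le_of_ne (not_lt.mp h2) (Ne.symm h3) : s (k + 1) < s k)
      omega
  have := hdesc n le_rfl
  have := (s 0).isLt
  omega

/-- colour by the distance to the next marker -/
def c1 {n : ℕ} (s : ℕ → Fin n) : Bool × Bool :=
  if D (2 * n + 3) s = 0 then (true, true)
  else if D (2 * n + 3) s % 2 = 0 then (true, false) else (false, true)

theorem c1_mk {n : ℕ} (s : ℕ → Fin n) (h : mk s) : c1 s = (true, true) := by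
  simp [c1, D, h]

theorem c1_tl {n : ℕ} (s : ℕ → Fin n) (h : s 0 ≠ s 1) : c1 (tl s) ≠ c1 s := by
  by_cases hm : mk s
  · have h2 := mk_tl s hm
    have h3 : D (2 * n + 3) (tl s) ≠ 0 := by simp [D, h2]
    rw [c1_mk s hm]
    unfold c1
    rw [if_neg h3]
    split_ifs <;> simp
  · have h2 : D (2 * n + 3) s = D (2 * n + 3) (tl s) + 1 := by
      rw [← D_fuel _ s (exists_mk s h)]
      conv_lhs => rw [D, if_neg hm]
    unfold c1
    rw [h2]
    split_ifs <;> first | omega | (simp; done) | (exfalso; simp_all)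

theorem pick_ex (a b c : Bool × Bool) : ∃ d : Bool × Bool, d ≠ a ∧ d ≠ b ∧ d ≠ c := by
  revert a b c; decide

noncomputable def pick (a b c : Bool × Bool) : Bool × Bool := (pick_ex a b c).choose

theorem pick_spec (a b c : Bool × Bool) : pick a b c ≠ a ∧ pick a b c ≠ b ∧ pick a b c ≠ c :=
  (pick_ex a b c).choose_spec

noncomputable def col {n : ℕ} (α : Fin n → Fin n → Bool × Bool) (s : ℕ → Fin n) : Bool × Bool :=
  if s 0 = s 1 then
    if s 1 = s 2 then α (s 0) (s 3) else pick (α (s 0) (s 2)) (c1 (tl s)) (true, true)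
  else c1 s

theorem c1_dep {n : ℕ} (s s' : ℕ → Fin n) (h : ∀ i < 2 * n + 7, s i = s' i) : c1 s = c1 s' := by
  unfold c1
  rw [D_dep _ s s' h]

theorem col_dep {n : ℕ} (α : Fin n → Fin n → Bool × Bool) (s s' : ℕ → Fin n)
    (h : ∀ i < 2 * n + 8, s i = s' i) : col α s = col α s' := by
  unfold col
  rw [h 0 (by omega), h 1 (by omega), h 2 (by omega), h 3 (by omega),
    c1_dep s s' (fun i hi => h i (by omega)),
    c1_dep (tl s) (tl s') (fun i hi => h (i + 1) (by omega))]

/-- proper colouring away from constant words -/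
theorem col_edge {n : ℕ} (α : Fin n → Fin n → Bool × Bool) (s : ℕ → Fin n)
    (h : ¬ (s 1 = s 2 ∧ s 2 = s 3)) : col α (tl s) ≠ col α s := by
  by_cases h12 : s 1 = s 2
  · have h23 : s 2 ≠ s 3 := fun e => h ⟨h12, e⟩
    have e1 : col α (tl s) = pick (α (s 1) (s 3)) (c1 (tl (tl s))) (true, true) := by
      simp [col, tl, h12, h23]
    have hp := pick_spec (α (s 1) (s 3)) (c1 (tl (tl s))) (true, true)
    by_cases h01 : s 0 = s 1
    · have e2 : col α s = α (s 1) (s 3) := by simp [col, h01, h12]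
      rw [e1, e2]; exact hp.1
    · have e2 : col α s = (true, true) := by
        have : mk s := Or.inl ⟨h01, h12⟩
        simp [col, h01, c1_mk s this]
      rw [e1, e2]; exact hp.2.2
  · have e1 : col α (tl s) = c1 (tl s) := by simp [col, tl, h12]
    rw [e1]
    by_cases h01 : s 0 = s 1
    · have e2 : col α s = pick (α (s 0) (s 2)) (c1 (tl s)) (true, true) := by
        rw [col, if_pos h01, if_neg h12]
      rw [e2]; exact (pick_spec _ _ _).2.1.symm
    · have e2 : col α s = c1 s := by rw [col, if_neg h01]
      rw [e2]; exact c1_tl s h01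

theorem col_const {n : ℕ} (α : Fin n → Fin n → Bool × Bool) (hα : ∀ i, α i i = (true, true))
    (s : ℕ → Fin n) (h : s 1 = s 2 ∧ s 2 = s 3) : col α s = (true, true) := by
  by_cases h01 : s 0 = s 1
  · have : s 0 = s 3 := by rw [h01, h.1, h.2]
    rw [col, if_pos h01, if_pos h.1, ← this, hα]
  · rw [col, if_neg h01]
    exact c1_mk s (Or.inl ⟨h01, h.1⟩)

theorem loop_lemma {n : ℕ} {B : Type*} (t : (Fin n → B) → B) (G : B → B → Prop)
    (hid : ∀ b, t (fun _ => b) = b)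
    (hG : ∀ p q : Fin n → B, (∀ j, G (p j) (q j)) → G (t p) (t q))
    (y : Bool × Bool → B) (hy : ∀ a b, a ≠ b → G (y a) (y b))
    (α : Fin n → Fin n → Bool × Bool) (hα : ∀ i, α i i = (true, true))
    (ht : ∀ i, G (t (fun j => y (α i j))) (y (true, true))) : ∃ b, G b b := by
  rcases Nat.eq_zero_or_pos n with hn | hn
  · subst hn
    exact ⟨t (fun j => j.elim0), hG _ _ (fun j => j.elim0)⟩
  let s0 : ℕ → Fin n := fun _ => ⟨0, hn⟩
  let F : (ℕ → Fin n) → B := fun s => y (col α s)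
  let F' : (ℕ → Fin n) → B := fun s =>
    if s 0 = s 1 ∧ s 1 = s 2 then t (fun j => y (α (s 0) j)) else F s
  let M := 2 * n + 4
  have h1 : E t s0 (M + 4 + 1) F = E t s0 (M + 4) F := by
    apply E_succ t s0 hid
    intro s s' h
    show y _ = y _
    rw [col_dep α s s' h]
  have h2 : E t s0 (M + 4) F' = E t s0 (M + 4) F := by
    show t (fun a => t (fun b => t (fun c => E t s0 (M + 1) _))) =
      t (fun a => t (fun b => t (fun c => E t s0 (M + 1) _)))
    congr 1; funext a; congr 1; funext b; congr 1; funext c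
    by_cases h : a = b ∧ b = c
    · obtain ⟨rfl, rfl⟩ := h
      have e1 : (fun s => F' (cons a (cons a (cons a s)))) =
          fun _ => t (fun j => y (α a j)) := by
        funext s; simp [F', cons]
      have e2 : (fun s => F (cons a (cons a (cons a s)))) =
          fun s => y (α a (s 0)) := by
        funext s; simp [F, col, cons]
      rw [e1, e2, E_const t s0 hid]
      show _ = t (fun j => E t s0 M (fun s => y (α a j)))
      congr 1; funext j
      rw [E_const t s0 hid]
    · have e1 : (fun s => F' (cons a (cons b (cons c s)))) =
          fun s => F (cons a (cons b (cons c s))) := by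
        funext s
        exact if_neg h
      rw [e1]
  have h3 : E t s0 (M + 4 + 1) (fun s => F' (tl s)) = E t s0 (M + 4) F' := E_tl t s0 hid _ _
  have h4 : G (E t s0 (M + 4 + 1) (fun s => F' (tl s))) (E t s0 (M + 4 + 1) F) := by
    apply E_mono t s0 G hG
    intro s
    by_cases h : s 1 = s 2 ∧ s 2 = s 3
    · have e1 : F' (tl s) = t (fun j => y (α (s 1) j)) := if_pos h
      have e2 : F s = y (true, true) := by
        show y _ = _
        rw [col_const α hα s h]
      rw [e1, e2]; exact ht _
    · have e1 : F' (tl s) = F (tl s) := if_neg h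
      rw [e1]
      exact hy _ _ (col_edge α s h)
  rw [h3, h2, h1] at h4
  exact ⟨_, h4⟩

theorem term_idem {A I : Type*} {ar : I → ℕ} (op : ∀ i : I, (Fin (ar i) → A) → A)
    (hidem : ∀ (i : I) (a : A), op i (fun _ => a) = a) {k : ℕ} {t : (Fin k → A) → A}
    (ht : IsTermOp op t) (a : A) : t (fun _ => a) = a := by
  induction ht with
  | proj j => rfl
  | comp i g hg ih => simp only [ih, hidem]

theorem term_comp {A I : Type*} {ar : I → ℕ} (op : ∀ i : I, (Fin (ar i) → A) → A)
    {k m : ℕ} {t : (Fin k → A) → A} (ht : IsTermOp op t) (g : Fin k → (Fin m → A) → A)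
    (hg : ∀ j, IsTermOp op (g j)) : IsTermOp op (fun x => t (fun j => g j x)) := by
  induction ht with
  | proj j => exact hg j
  | comp i h hh ih => exact IsTermOp.comp i _ ih

def sel {A : Type*} (b : Bool) (x y : A) : A := if b then x else y

end DLoop

/-- If an idempotent algebra `(A, (op i))` satisfies a Taylor system of equations locally on a
subset `X`, then it has a 12-ary term operation `d` satisfying the double loop equations
locally on `X`. -/
theorem local_double_loop_term {A I : Type*} {ar : I → ℕ}
    (op : ∀ i : I, (Fin (ar i) → A) → A)
    (X : Set A)
    (hidem : ∀ (i : I) (a : A), op i (fun _ => a) = a)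
    (htaylor : ∃ (n : ℕ) (t : (Fin n → A) → A), IsTermOp op t ∧
      ∀ i : Fin n, ∃ z z' : Fin n → Bool, z i = true ∧ z' i = false ∧
        ∀ x ∈ X, ∀ y ∈ X,
          t (fun j => if z j then x else y) = t (fun j => if z' j then x else y)) :
    ∃ d : (Fin 12 → A) → A, IsTermOp op d ∧
      ∀ x ∈ X, ∀ y ∈ X,
        d ![x, x, x, x, x, x, y, y, y, y, y, y] = d ![x, x, y, y, y, y, x, x, x, x, y, y] ∧
        d ![x, y, x, x, y, y, x, x, y, y, x, y] = d ![y, x, x, y, x, y, x, y, x, y, y, x] := by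
  obtain ⟨n, t, ht, hT⟩ := htaylor
  choose z z' hz hz' hzz using hT
  let G : (Bool → X → X → A) → (Bool → X → X → A) → Prop := fun p q =>
    ∃ d : (Fin 12 → A) → A, IsTermOp op d ∧ ∀ x y : X,
      p true x y = d ![x, x, x, x, x, x, y, y, y, y, y, y] ∧
      q true x y = d ![x, x, y, y, y, y, x, x, x, x, y, y] ∧
      p false x y = d ![x, y, x, x, y, y, x, x, y, y, x, y] ∧
      q false x y = d ![y, x, x, y, x, y, x, y, x, y, y, x]
  let T : (Fin n → (Bool → X → X → A)) → (Bool → X → X → A) :=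
    fun p b x y => t (fun j => p j b x y)
  let v : Bool × Bool → (Bool → X → X → A) := fun c b x y =>
    DLoop.sel (if b then c.1 else c.2) x.1 y.1
  have hid : ∀ b, T (fun _ => b) = b := by
    intro b
    funext c x y
    exact DLoop.term_idem op hidem ht _
  have hG : ∀ p q : Fin n → (Bool → X → X → A), (∀ j, G (p j) (q j)) → G (T p) (T q) := by
    intro p q h
    choose d hd hd' using h
    refine ⟨fun x => t (fun j => d j x), DLoop.term_comp op ht d hd, fun x y => ⟨?_, ?_, ?_, ?_⟩⟩
    · show t _ = t _
      congr 1; funext j; exact (hd' j x y).1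
    · show t _ = t _
      congr 1; funext j; exact (hd' j x y).2.1
    · show t _ = t _
      congr 1; funext j; exact (hd' j x y).2.2.1
    · show t _ = t _
      congr 1; funext j; exact (hd' j x y).2.2.2
  have hv : ∀ a b, a ≠ b → G (v a) (v b) := by
    have proj : ∀ (k : Fin 12) (a b : Bool × Bool), (∀ x y : X,
      v a true x y = (![x, x, x, x, x, x, y, y, y, y, y, y] : Fin 12 → A) k ∧
      v b true x y = (![x, x, y, y, y, y, x, x, x, x, y, y] : Fin 12 → A) k ∧
      v a false x y = (![x, y, x, x, y, y, x, x, y, y, x, y] : Fin 12 → A) k ∧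
      v b false x y = (![y, x, x, y, x, y, x, y, x, y, y, x] : Fin 12 → A) k) →
      G (v a) (v b) := fun k a b h => ⟨fun x => x k, IsTermOp.proj k, h⟩
    rintro ⟨_ | _, _ | _⟩ ⟨_ | _, _ | _⟩ hab
    all_goals first
      | exact absurd rfl hab
      | exact proj 0 _ _ (fun x y => ⟨rfl, rfl, rfl, rfl⟩)
      | exact proj 1 _ _ (fun x y => ⟨rfl, rfl, rfl, rfl⟩)
      | exact proj 2 _ _ (fun x y => ⟨rfl, rfl, rfl, rfl⟩)
      | exact proj 3 _ _ (fun x y => ⟨rfl, rfl, rfl, rfl⟩)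
      | exact proj 4 _ _ (fun x y => ⟨rfl, rfl, rfl, rfl⟩)
      | exact proj 5 _ _ (fun x y => ⟨rfl, rfl, rfl, rfl⟩)
      | exact proj 6 _ _ (fun x y => ⟨rfl, rfl, rfl, rfl⟩)
      | exact proj 7 _ _ (fun x y => ⟨rfl, rfl, rfl, rfl⟩)
      | exact proj 8 _ _ (fun x y => ⟨rfl, rfl, rfl, rfl⟩)
      | exact proj 9 _ _ (fun x y => ⟨rfl, rfl, rfl, rfl⟩)
      | exact proj 10 _ _ (fun x y => ⟨rfl, rfl, rfl, rfl⟩)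
      | exact proj 11 _ _ (fun x y => ⟨rfl, rfl, rfl, rfl⟩)
  obtain ⟨b, d, hd, hb⟩ := DLoop.loop_lemma T G hid hG v hv (fun i j => (z i j, !(z' i j)))
    (fun i => by simp [hz, hz']) (by
      intro i
      have e : T (fun j => v (z i j, !(z' i j))) = T (fun j => v (z' i j, !(z' i j))) := by
        funext c x y
        cases c with
        | false => rfl
        | true => exact hzz i x.1 x.2 y.1 y.2
      rw [e, ← hid (v (true, true))]
      apply hG
      intro j
      apply hv
      cases z' i j <;> simp)
  refine ⟨d, hd, fun x hx y hy => ?_⟩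
  obtain ⟨h1, h2, h3, h4⟩ := hb ⟨x, hx⟩ ⟨y, hy⟩
  exact ⟨h1.symm.trans h2, h3.symm.trans h4⟩
end
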